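/- arXiv:math/0611490 — 3 statements merged into one kernel-verified Lean document; each statement's English description precedes it below -/
import Mathlib

section
/- (Main theorem, case n = 2k with k ≥ 7, upper bound) Let k ≥ 7. Every edge coloring of the complete graph K_{2k} using at least (2k-3 choose 2) + 3 colors contains a rainbow matching of size k. -/
/-- The number of colors used by an edge coloring `c` of the complete graph on `Fin n`:
the cardinality of the image of `c` on the edge set. -/
def numColors {n : ℕ} (c : Sym2 (Fin n) → ℕ) : ℕ :=
  (((⊤ : SimpleGraph (Fin n)).edgeFinset).image c).card

/-- The coloring `c` of the complete graph on `Fin n` admits a rainbow matching of size `k`: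
`k` pairwise disjoint edges with pairwise distinct colors. -/
def HasRainbowMatching {n : ℕ} (c : Sym2 (Fin n) → ℕ) (k : ℕ) : Prop :=
  ∃ s : Finset (Sym2 (Fin n)), s.card = k ∧ (∀ e ∈ s, ¬ e.IsDiag) ∧
    ((s : Set (Sym2 (Fin n))).Pairwise fun e f => ∀ v, v ∈ e → v ∉ f) ∧
    Set.InjOn c ↑s

section Matching

open scoped Classical

variable {V : Type*}

/-- `G` has a perfect matching on the vertex set `W`, encoded as an involution. -/
def HasPerfectMatchingOn (G : SimpleGraph V) (W : Finset V) : Prop :=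
  ∃ σ : V → V, ∀ x ∈ W, σ x ∈ W ∧ σ (σ x) = x ∧ G.Adj x (σ x)

/-- The neighbours of `x` inside `W`. -/
noncomputable def nbr (G : SimpleGraph V) (W : Finset V) (x : V) : Finset V :=
  W.filter fun y => G.Adj x y

/-- The vertices of `W` other than `x` that are not adjacent to `x`. -/
noncomputable def nonNbr (G : SimpleGraph V) (W : Finset V) (x : V) : Finset V :=
  W.filter fun y => y ≠ x ∧ ¬ G.Adj x y

/-- Twice the number of edges missing from `G` inside `W`. -/
noncomputable def missing (G : SimpleGraph V) (W : Finset V) : ℕ :=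
  ∑ x ∈ W, (nonNbr G W x).card

lemma mem_nbr {G : SimpleGraph V} {W : Finset V} {x y : V} :
    y ∈ nbr G W x ↔ y ∈ W ∧ G.Adj x y := by
  simp [nbr]

lemma mem_nonNbr {G : SimpleGraph V} {W : Finset V} {x y : V} :
    y ∈ nonNbr G W x ↔ y ∈ W ∧ y ≠ x ∧ ¬ G.Adj x y := by
  simp [nonNbr]

lemma card_nbr_add_card_nonNbr (G : SimpleGraph V) {W : Finset V} {x : V} (hx : x ∈ W) :
    (nbr G W x).card + (nonNbr G W x).card + 1 = W.card := by
  have hd : Disjoint (nbr G W x) (nonNbr G W x) := by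
    rw [Finset.disjoint_left]
    intro y hy hy'
    exact (mem_nonNbr.1 hy').2.2 (mem_nbr.1 hy).2
  have h : nbr G W x ∪ nonNbr G W x = W.erase x := by
    ext y
    simp only [Finset.mem_union, mem_nbr, mem_nonNbr, Finset.mem_erase]
    constructor
    · rintro (⟨h1, h2⟩ | ⟨h1, h2, -⟩)
      · exact ⟨h2.ne', h1⟩
      · exact ⟨h2, h1⟩
    · rintro ⟨h1, h2⟩
      tauto
  rw [← Finset.card_union_of_disjoint hd, h, Finset.card_erase_add_one hx]

lemma card_nonNbr_erase (G : SimpleGraph V) {W : Finset V} {p x : V} (hp : p ∈ W) (hx : p ≠ x) :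
    (nonNbr G W x).card = (nonNbr G (W.erase p) x).card + if G.Adj x p then 0 else 1 := by
  split_ifs with h
  · congr 1
    ext y
    simp only [mem_nonNbr, Finset.mem_erase]
    constructor
    · rintro ⟨h1, h2, h3⟩
      exact ⟨⟨fun e => h3 (e ▸ h), h1⟩, h2, h3⟩
    · tauto
  · have : nonNbr G (W.erase p) x = (nonNbr G W x).erase p := by
      ext y
      simp only [mem_nonNbr, Finset.mem_erase]
      tauto
    rw [this, Finset.card_erase_add_one]
    exact mem_nonNbr.2 ⟨hp, hx, h⟩

lemma missing_erase (G : SimpleGraph V) {W : Finset V} {p : V} (hp : p ∈ W) :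
    missing G W = missing G (W.erase p) + 2 * (nonNbr G W p).card := by
  have h1 : missing G W =
      ∑ x ∈ W.erase p, (nonNbr G W x).card + (nonNbr G W p).card :=
    (Finset.sum_erase_add W _ hp).symm
  have h2 : ∑ x ∈ W.erase p, (nonNbr G W x).card =
      missing G (W.erase p) + ∑ x ∈ W.erase p, if G.Adj x p then 0 else 1 := by
    rw [missing, ← Finset.sum_add_distrib]
    exact Finset.sum_congr rfl fun x hx =>
      card_nonNbr_erase G hp (Finset.ne_of_mem_erase hx).symm
  have h3 : (∑ x ∈ W.erase p, if G.Adj x p then 0 else 1) = (nonNbr G W p).card := by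
    rw [Finset.card_eq_sum_ones, nonNbr, Finset.sum_filter, ← Finset.sum_erase_add W _ hp]
    simp only [ne_eq, not_true_eq_false, false_and, if_false, add_zero]
    refine Finset.sum_congr rfl fun x hx => ?_
    have := Finset.ne_of_mem_erase hx
    rw [G.adj_comm]
    by_cases h : G.Adj p x <;> simp [h, this]
  omega

/-- Vertices with many non-neighbours force many missing edges. -/
lemma le_missing_add (G : SimpleGraph V) {W I : Finset V} (hI : I ⊆ W) {d : ℕ}
    (hd : ∀ x ∈ I, d ≤ (nonNbr G W x).card) :
    2 * (I.card * d) ≤ missing G W + I.card * (I.card - 1) := by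
  induction I using Finset.induction_on generalizing W d with
  | empty => simp
  | insert p I hp ih =>
    have hpW : p ∈ W := hI (Finset.mem_insert_self _ _)
    have hsub : I ⊆ W.erase p := fun x hx =>
      Finset.mem_erase.2 ⟨fun e => hp (e ▸ hx), hI (Finset.mem_insert_of_mem hx)⟩
    have h1 := ih hsub (d := d - 1) fun x hx => by
      have h2 := hd x (Finset.mem_insert_of_mem hx)
      have h3 := card_nonNbr_erase G hpW (x := x) (fun e => hp (e ▸ hx))
      split_ifs at h3 <;> omega
    have h4 := missing_erase G hpW
    have h5 := hd p (Finset.mem_insert_self _ _)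
    rw [Finset.card_insert_of_notMem hp]
    rcases d with _ | d
    · simp
    · generalize I.card = n at *
      rcases n with _ | n
      · simp at h1 ⊢; omega
      · simp only [Nat.add_sub_cancel] at h1 ⊢
        nlinarith

lemma HasPerfectMatchingOn.mono {G H : SimpleGraph V} {W : Finset V}
    (h : HasPerfectMatchingOn G W) (hGH : ∀ x ∈ W, ∀ y ∈ W, G.Adj x y → H.Adj x y) :
    HasPerfectMatchingOn H W := by
  obtain ⟨σ, hσ⟩ := h
  exact ⟨σ, fun x hx => ⟨(hσ x hx).1, (hσ x hx).2.1, hGH _ hx _ (hσ x hx).1 (hσ x hx).2.2⟩⟩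

lemma HasPerfectMatchingOn.of_erase {G : SimpleGraph V} {W : Finset V} {p q : V} (hp : p ∈ W)
    (hq : q ∈ W) (hpq : G.Adj p q) (h : HasPerfectMatchingOn G ((W.erase p).erase q)) :
    HasPerfectMatchingOn G W := by
  obtain ⟨σ, hσ⟩ := h
  have hne := hpq.ne
  refine ⟨fun x => if x = p then q else if x = q then p else σ x, fun x hx => ?_⟩
  by_cases hxp : x = p
  · subst hxp
    simp [hne.symm, hq, hpq]
  by_cases hxq : x = q
  · subst hxq
    simp [hne.symm, hp, hpq.symm]
  have h1 := hσ x (by simp [hxp, hxq, hx])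
  have h2 := h1.1
  simp only [Finset.mem_erase] at h2
  simp only [hxp, hxq, if_false, h2.1, h2.2.1]
  exact ⟨h2.2.2, h1.2⟩

lemma hasPerfectMatchingOn_of_complete {G : SimpleGraph V} {W : Finset V} {m : ℕ}
    (hW : W.card = 2 * m) (h : ∀ x ∈ W, ∀ y ∈ W, x ≠ y → G.Adj x y) :
    HasPerfectMatchingOn G W := by
  induction m generalizing W with
  | zero =>
    have : W = ∅ := Finset.card_eq_zero.1 hW
    subst this
    exact ⟨id, by simp⟩
  | succ m ih =>
    obtain ⟨p, hp, q, hq, hpq⟩ := Finset.one_lt_card.1 (show 1 < W.card by omega)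
    refine .of_erase hp hq (h p hp q hq hpq) (ih ?_ ?_)
    · rw [Finset.card_erase_of_mem (Finset.mem_erase.2 ⟨hpq.symm, hq⟩),
        Finset.card_erase_of_mem hp]
      omega
    · intro x hx y hy
      simp only [Finset.mem_erase] at hx hy
      exact h x hx.2.2 y hy.2.2

/-- The Bondy–Chvátal closure step for perfect matchings. -/
lemma HasPerfectMatchingOn.of_sup_edge {G : SimpleGraph V} {W : Finset V} {u v : V} (hu : u ∈ W)
    (hv : v ∈ W) (huv : u ≠ v) (h : HasPerfectMatchingOn (G ⊔ SimpleGraph.edge u v) W)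
    (hdeg : W.card ≤ (nbr G W u).card + (nbr G W v).card + 1) : HasPerfectMatchingOn G W := by
  by_cases hadj : G.Adj u v
  · refine h.mono fun x _ y _ hxy => ?_
    rw [SimpleGraph.sup_adj, SimpleGraph.edge_adj] at hxy
    rcases hxy with hxy | ⟨⟨rfl, rfl⟩ | ⟨rfl, rfl⟩, -⟩
    exacts [hxy, hadj, hadj.symm]
  obtain ⟨σ, hσ⟩ := h
  have hG : ∀ x ∈ W, ¬(x = u ∧ σ x = v) → ¬(x = v ∧ σ x = u) → G.Adj x (σ x) := by
    intro x hx h1 h2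
    have h3 := (hσ x hx).2.2
    rw [SimpleGraph.sup_adj, SimpleGraph.edge_adj] at h3
    rcases h3 with h3 | ⟨h3 | h3, -⟩
    · exact h3
    · exact absurd h3 (by tauto)
    · exact absurd h3 (by tauto)
  by_cases hσu : σ u = v
  swap
  · refine ⟨σ, fun x hx => ⟨(hσ x hx).1, (hσ x hx).2.1, hG x hx ?_ ?_⟩⟩
    · rintro ⟨rfl, h⟩; exact hσu h
    · rintro ⟨rfl, h⟩
      exact hσu (by rw [← h, (hσ x hx).2.1])
  have hσv : σ v = u := by rw [← hσu, (hσ u hu).2.1]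
  have hinj : ∀ x ∈ W, ∀ y ∈ W, σ x = σ y → x = y := fun x hx y hy e => by
    rw [← (hσ x hx).2.1, e, (hσ y hy).2.1]
  obtain ⟨x, hx⟩ : ∃ x, x ∈ nbr G W u ∩ (nbr G W v).image σ := by
    by_contra! hempty
    have h1 : (nbr G W u ∪ (nbr G W v).image σ).card =
        (nbr G W u).card + (nbr G W v).card := by
      rw [Finset.card_union_of_disjoint
        (Finset.disjoint_iff_inter_eq_empty.2 (Finset.eq_empty_of_forall_notMem hempty)),
        Finset.card_image_of_injOn]
      intro a ha b hb
      exact hinj a (mem_nbr.1 ha).1 b (mem_nbr.1 hb).1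
    have h2 : nbr G W u ∪ (nbr G W v).image σ ⊆ (W.erase u).erase v := by
      intro y hy
      rw [Finset.mem_union, Finset.mem_image] at hy
      simp only [Finset.mem_erase]
      rcases hy with hy | ⟨z, hz, rfl⟩
      · rw [mem_nbr] at hy
        exact ⟨fun e => hadj (e ▸ hy.2), hy.2.ne', hy.1⟩
      · rw [mem_nbr] at hz
        refine ⟨fun e => ?_, fun e => ?_, (hσ z hz.1).1⟩
        · have := hinj z hz.1 u hu (e.trans hσu.symm)
          exact hadj (this ▸ hz.2).symm
        · exact hz.2.ne (hinj z hz.1 v hv (e.trans hσv.symm)).symm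
    have h3 := Finset.card_le_card h2
    rw [h1, Finset.card_erase_of_mem (Finset.mem_erase.2 ⟨huv.symm, hv⟩),
        Finset.card_erase_of_mem hu] at h3
    have : 1 < W.card := Finset.one_lt_card.2 ⟨u, hu, v, hv, huv⟩
    omega
  rw [Finset.mem_inter, Finset.mem_image] at hx
  obtain ⟨hux, y, hvy, hyx⟩ := hx
  rw [mem_nbr] at hux hvy
  have hxy : σ x = y := by rw [← hyx, (hσ y hvy.1).2.1]
  have hxu : x ≠ u := hux.2.ne'
  have hyv : y ≠ v := hvy.2.ne'
  have hxv : x ≠ v := fun e => hadj (e ▸ hux.2)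
  have hyu : y ≠ u := fun e => hadj (e ▸ hvy.2).symm
  have hxy' : x ≠ y := fun e => by
    have := (hσ y hvy.1).2.2
    rw [hyx, e] at this
    exact this.ne rfl
  refine ⟨fun z => if z = u then x else if z = x then u else if z = v then y else
    if z = y then v else σ z, fun z hz => ?_⟩
  by_cases hzu : z = u
  · subst hzu; simp [hxu, hux]
  by_cases hzx : z = x
  · subst hzx; simp [hxu, hu, hux.2.symm]
  by_cases hzv : z = v
  · subst hzv; simp [huv.symm, hxv.symm, hyu, hxy'.symm, hyv, hvy]
  by_cases hzy : z = y
  · subst hzy; simp [huv.symm, hxv.symm, hyu, hxy'.symm, hyv, hvy.2.symm, hv]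
  have h1 : σ z ≠ u := fun e => hzv (hinj z hz v hv (e.trans hσv.symm))
  have h2 : σ z ≠ v := fun e => hzu (hinj z hz u hu (e.trans hσu.symm))
  have h3 : σ z ≠ x := fun e => hzy (hinj z hz y hvy.1 (e.trans hyx.symm))
  have h4 : σ z ≠ y := fun e => hzx (hinj z hz x hux.1 (e.trans hxy.symm))
  simp only [hzu, hzx, hzv, hzy, h1, h2, h3, h4, if_false]
  exact ⟨(hσ z hz).1, (hσ z hz).2.1, hG z hz (by tauto) (by tauto)⟩

/-- A degree condition in the style of Chvátal: a graph without a perfect matching on `2 * m`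
vertices has, for some `h < m`, more than `h` vertices of degree at most `h`. -/
lemma exists_low_degree_of_not_hasPerfectMatchingOn [Finite V] {G : SimpleGraph V} {W : Finset V}
    {m : ℕ} (hW : W.card = 2 * m) (hG : ¬ HasPerfectMatchingOn G W) :
    ∃ (h : ℕ) (I : Finset V), I ⊆ W ∧ h + 1 ≤ m ∧ h + 1 ≤ I.card ∧
      (h + 1 = m → m + 1 ≤ I.card) ∧ ∀ x ∈ I, (nbr G W x).card ≤ h := by
  obtain ⟨H, hGH, hH⟩ :=
    (Set.toFinite {H : SimpleGraph V | ¬ HasPerfectMatchingOn H W}).exists_le_maximal hG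
  have hmono : ∀ x, (nbr G W x).card ≤ (nbr H W x).card := fun x =>
    Finset.card_le_card fun y hy => mem_nbr.2 ⟨(mem_nbr.1 hy).1, hGH (mem_nbr.1 hy).2⟩
  have hsum : ∀ u ∈ W, ∀ v ∈ W, u ≠ v → ¬ H.Adj u v →
      (nbr H W u).card + (nbr H W v).card + 2 ≤ W.card := by
    intro u hu v hv huv hadj
    by_contra hcon
    refine hH.prop (HasPerfectMatchingOn.of_sup_edge hu hv huv ?_ (by omega))
    by_contra hno
    have := hH.le_of_ge (y := H ⊔ SimpleGraph.edge u v) hno le_sup_left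
    exact hadj (this (by rw [SimpleGraph.sup_adj, SimpleGraph.edge_adj]; tauto))
  set P := (W ×ˢ W).filter fun e => e.1 ≠ e.2 ∧ ¬ H.Adj e.1 e.2 with hP
  have hPne : P.Nonempty := by
    by_contra hempty
    rw [Finset.not_nonempty_iff_eq_empty] at hempty
    refine hH.prop (hasPerfectMatchingOn_of_complete hW fun x hx y hy hxy => ?_)
    by_contra hadj
    have : (x, y) ∈ P := by simp [hP, hx, hy, hxy, hadj]
    simp [hempty] at this
  obtain ⟨⟨a, b⟩, hab, hmax⟩ :=
    Finset.exists_max_image P (fun e => (nbr H W e.1).card + (nbr H W e.2).card) hPne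
  obtain ⟨u, v, hu, hv, huv, hadj, hle, hmax⟩ : ∃ u v, u ∈ W ∧ v ∈ W ∧ u ≠ v ∧ ¬ H.Adj u v ∧
      (nbr H W u).card ≤ (nbr H W v).card ∧ ∀ w ∈ W, w ≠ v → ¬ H.Adj v w →
        (nbr H W w).card ≤ (nbr H W u).card := by
    simp only [hP, Finset.mem_filter, Finset.mem_product, Prod.forall] at hab hmax
    rcases le_total (nbr H W a).card (nbr H W b).card with hle | hle
    · refine ⟨a, b, hab.1.1, hab.1.2, hab.2.1, hab.2.2, hle, fun w hw hwv hn => ?_⟩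
      have := hmax w b ⟨⟨hw, hab.1.2⟩, hwv, fun h => hn h.symm⟩
      omega
    · refine ⟨b, a, hab.1.2, hab.1.1, hab.2.1.symm, fun h => hab.2.2 h.symm, hle,
        fun w hw hwv hn => ?_⟩
      have := hmax w a ⟨⟨hw, hab.1.1⟩, hwv, fun h => hn h.symm⟩
      omega
  have hs := hsum u hu v hv huv hadj
  have hc := card_nbr_add_card_nonNbr H hv
  have hlow : ∀ w ∈ nonNbr H W v, (nbr H W w).card ≤ (nbr H W u).card := fun w hw =>
    hmax w (mem_nonNbr.1 hw).1 (mem_nonNbr.1 hw).2.1 (mem_nonNbr.1 hw).2.2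
  have hv' : v ∉ nonNbr H W v := fun h => (mem_nonNbr.1 h).2.1 rfl
  have hsub : nonNbr H W v ⊆ W := Finset.filter_subset _ _
  by_cases hm : (nbr H W u).card + 1 = m
  · refine ⟨_, insert v (nonNbr H W v), Finset.insert_subset hv hsub, hm.le, ?_, fun _ => ?_,
      fun x hx => (hmono x).trans ?_⟩
    · rw [Finset.card_insert_of_notMem hv']; omega
    · rw [Finset.card_insert_of_notMem hv']; omega
    · rcases Finset.mem_insert.1 hx with rfl | hx
      · omega
      · exact hlow x hx
  · exact ⟨_, nonNbr H W v, hsub, by omega, by omega, fun h => absurd h hm,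
      fun x hx => (hmono x).trans (hlow x hx)⟩

/-- Dirac's condition for perfect matchings, stated with non-neighbours. -/
lemma hasPerfectMatchingOn_of_card_nonNbr_lt [Finite V] {G : SimpleGraph V} {W : Finset V} {m : ℕ}
    (hW : W.card = 2 * m) (h : ∀ x ∈ W, (nonNbr G W x).card < m) :
    HasPerfectMatchingOn G W := by
  by_contra hG
  obtain ⟨d, I, hIW, hdm, hdI, -, hI⟩ := exists_low_degree_of_not_hasPerfectMatchingOn hW hG
  obtain ⟨x, hx⟩ := Finset.card_pos.1 (show 0 < I.card by omega)
  have h1 := hI x hx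
  have h2 := h x (hIW hx)
  have h3 := card_nbr_add_card_nonNbr G (hIW hx)
  omega

end Matching

section Rainbow

open scoped Classical

variable {V : Type*}

/-- The edges of some perfect matching receive pairwise distinct colors under `c`. -/
def HasRainbowPerfectMatching (c : Sym2 V → ℕ) (W : Finset V) : Prop :=
  ∃ S : Set (Sym2 V), Set.InjOn c S ∧ HasPerfectMatchingOn (SimpleGraph.fromEdgeSet S) W

/-- The edges of `G` whose color differs from `γ`. -/
def avoidColor (G : SimpleGraph V) (c : Sym2 V → ℕ) (γ : ℕ) : SimpleGraph V :=
  SimpleGraph.fromEdgeSet {e | e ∈ G.edgeSet ∧ c e ≠ γ}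

lemma avoidColor_adj {G : SimpleGraph V} {c : Sym2 V → ℕ} {γ : ℕ} {x y : V} :
    (avoidColor G c γ).Adj x y ↔ G.Adj x y ∧ c s(x, y) ≠ γ := by
  simp only [avoidColor, SimpleGraph.fromEdgeSet_adj, Set.mem_ofPred_eq, SimpleGraph.mem_edgeSet]
  exact ⟨fun h => h.1, fun h => ⟨h, h.1.ne⟩⟩

/-- The ends in `W` of the edges of `G` with color `γ`. -/
noncomputable def colorEnds (G : SimpleGraph V) (c : Sym2 V → ℕ) (γ : ℕ) (W : Finset V) :
    Finset V :=
  W.filter fun x => ∃ y, G.Adj x y ∧ c s(x, y) = γ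

lemma mem_colorEnds {G : SimpleGraph V} {c : Sym2 V → ℕ} {γ : ℕ} {W : Finset V} {x : V} :
    x ∈ colorEnds G c γ W ↔ x ∈ W ∧ ∃ y, G.Adj x y ∧ c s(x, y) = γ := by
  simp [colorEnds]

lemma injOn_insert_of_ne {c : Sym2 V → ℕ} {S : Set (Sym2 V)} {e : Sym2 V} (hS : Set.InjOn c S)
    (he : ∀ e' ∈ S, c e' ≠ c e) : Set.InjOn c (insert e S) := by
  rintro x (rfl | hx) y (rfl | hy) hxy
  · rfl
  · exact absurd hxy.symm (he y hy)
  · exact absurd hxy (he x hx)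
  · exact hS hx hy hxy

section

variable {G : SimpleGraph V} {c : Sym2 V → ℕ}

lemma card_filter_color_le_one (hc : Set.InjOn c G.edgeSet) (W : Finset V) (γ : ℕ) (x : V) :
    (W.filter fun y => G.Adj x y ∧ c s(x, y) = γ).card ≤ 1 := by
  rw [Finset.card_le_one]
  intro y hy z hz
  simp only [Finset.mem_filter] at hy hz
  have := hc (G.mem_edgeSet.2 hy.2.1) (G.mem_edgeSet.2 hz.2.1) (hy.2.2.trans hz.2.2.symm)
  exact Sym2.congr_right.1 this

lemma card_colorEnds_le_two (hc : Set.InjOn c G.edgeSet) (γ : ℕ) (W : Finset V) :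
    (colorEnds G c γ W).card ≤ 2 := by
  rcases (colorEnds G c γ W).eq_empty_or_nonempty with h | ⟨a, ha⟩
  · simp [h]
  obtain ⟨-, b, hab, hγ⟩ := mem_colorEnds.1 ha
  refine (Finset.card_le_card (t := {a, b}) fun x hx => ?_).trans Finset.card_le_two
  obtain ⟨-, y, hxy, hγ'⟩ := mem_colorEnds.1 hx
  have h := hc (G.mem_edgeSet.2 hxy) (G.mem_edgeSet.2 hab) (hγ'.trans hγ.symm)
  have hx : x ∈ s(a, b) := h ▸ Sym2.mem_mk_left x y
  simpa using hx

lemma nbr_avoidColor_of_notMem {γ : ℕ} {W U : Finset V} {x : V} (hx : x ∈ W)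
    (h : x ∉ colorEnds G c γ W) : nbr (avoidColor G c γ) U x = nbr G U x := by
  ext y
  simp only [mem_colorEnds, not_and, not_exists] at h
  simp only [mem_nbr, avoidColor_adj]
  have := h hx y
  tauto

lemma nonNbr_avoidColor_of_notMem {γ : ℕ} {W U : Finset V} {x : V} (hx : x ∈ W)
    (h : x ∉ colorEnds G c γ W) : nonNbr (avoidColor G c γ) U x = nonNbr G U x := by
  ext y
  simp only [mem_colorEnds, not_and, not_exists] at h
  simp only [mem_nonNbr, avoidColor_adj]
  have := h hx y
  tauto

lemma card_nonNbr_avoidColor_le (hc : Set.InjOn c G.edgeSet) (γ : ℕ) (W : Finset V) (x : V) :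
    (nonNbr (avoidColor G c γ) W x).card ≤ (nonNbr G W x).card + 1 := by
  refine (Finset.card_le_card (t := nonNbr G W x ∪
    W.filter fun y => G.Adj x y ∧ c s(x, y) = γ) fun y hy => ?_).trans
    ((Finset.card_union_le _ _).trans
      (Nat.add_le_add_left (card_filter_color_le_one hc W γ x) _))
  simp only [Finset.mem_union, Finset.mem_filter, mem_nonNbr, avoidColor_adj] at hy ⊢
  tauto

lemma missing_avoidColor_le (hc : Set.InjOn c G.edgeSet) (γ : ℕ) (W : Finset V) :
    missing (avoidColor G c γ) W ≤ missing G W + (colorEnds G c γ W).card := by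
  have h : (colorEnds G c γ W).card = ∑ x ∈ W, if x ∈ colorEnds G c γ W then 1 else 0 := by
    rw [Finset.sum_ite_mem, Finset.inter_eq_right.2 fun x hx => (mem_colorEnds.1 hx).1]
    simp
  rw [h, missing, missing, ← Finset.sum_add_distrib]
  refine Finset.sum_le_sum fun x hx => ?_
  split_ifs with hx'
  · exact card_nonNbr_avoidColor_le hc γ W x
  · rw [nonNbr_avoidColor_of_notMem hx hx', add_zero]

lemma not_hasPerfectMatchingOn_avoidColor (hc : Set.InjOn c G.edgeSet) {W : Finset V}
    (hno : ¬ HasRainbowPerfectMatching c W) {p q : V} (hp : p ∈ W) (hq : q ∈ W) (hpq : p ≠ q) :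
    ¬ HasPerfectMatchingOn (avoidColor G c (c s(p, q))) ((W.erase p).erase q) := by
  intro h
  refine hno ⟨insert s(p, q) {e | e ∈ G.edgeSet ∧ c e ≠ c s(p, q)},
    injOn_insert_of_ne (hc.mono fun e he => he.1) fun e he => he.2, .of_erase hp hq ?_
      (h.mono fun x _ y _ hxy => ?_)⟩
  · simp [hpq]
  · rw [avoidColor, SimpleGraph.fromEdgeSet_adj] at hxy
    rw [SimpleGraph.fromEdgeSet_adj]
    exact ⟨Or.inr hxy.1, hxy.2⟩

variable [Fintype V] {k : ℕ}

lemma card_erase_erase (hV : Fintype.card V = 2 * k) {p q : V} (hpq : p ≠ q) :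
    ((Finset.univ.erase p).erase q).card = 2 * (k - 1) := by
  rw [Finset.card_erase_of_mem (by simp [hpq.symm]), Finset.card_erase_of_mem (by simp),
    Finset.card_univ, hV]
  omega

lemma isolated_or_exceptional (hk : 7 ≤ k) (hV : Fintype.card V = 2 * k)
    (hc : Set.InjOn c G.edgeSet) (hmiss : missing G Finset.univ + 18 ≤ 12 * k)
    (hno : ¬ HasRainbowPerfectMatching c Finset.univ) {p q : V} (hpq : p ≠ q)
    (hD : (∀ w, w ≠ p → w ≠ q →
        (nonNbr G Finset.univ w).card ≤ (nonNbr G Finset.univ p).card ∧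
        (nonNbr G Finset.univ w).card ≤ (nonNbr G Finset.univ q).card) ∨
      (2 * k ≤ (nonNbr G Finset.univ p).card + 4 ∧
        2 * k ≤ (nonNbr G Finset.univ q).card + 4)) :
    (∃ z, z ≠ p ∧ z ≠ q ∧
      nbr (avoidColor G c (c s(p, q))) ((Finset.univ.erase p).erase q) z = ∅) ∨
    (k = 7 ∧ 6 ≤ (nonNbr G Finset.univ p).card ∧ 6 ≤ (nonNbr G Finset.univ q).card ∧
      (nonNbr G Finset.univ p).card + (nonNbr G Finset.univ q).card ≤
        12 + (if G.Adj p q then 0 else 2) ∧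
      ∃ I ⊆ (Finset.univ.erase p).erase q, 7 ≤ I.card ∧
        ∀ x ∈ I, (nbr (avoidColor G c (c s(p, q)))
          ((Finset.univ.erase p).erase q) x).card ≤ 5) := by
  have hW := card_erase_erase hV hpq
  obtain ⟨h, I, hIW, hh, hhI, hhI', hI⟩ := exists_low_degree_of_not_hasPerfectMatchingOn hW
    (not_hasPerfectMatchingOn_avoidColor hc hno (Finset.mem_univ p) (Finset.mem_univ q) hpq)
  set W := (Finset.univ.erase p).erase q with hWdef
  set G' := avoidColor G c (c s(p, q)) with hG'
  set F := colorEnds G c (c s(p, q)) W with hF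
  have hnon : ∀ x ∈ I, 2 * k - 3 - h ≤ (nonNbr G' W x).card := fun x hx => by
    have h1 := card_nbr_add_card_nonNbr G' (hIW hx)
    have h2 := hI x hx
    omega
  have hWuniv : ∀ x, (nonNbr G W x).card ≤ (nonNbr G Finset.univ x).card := fun x =>
    Finset.card_le_card (Finset.filter_subset_filter _ (Finset.subset_univ _))
  have hFc : F.card ≤ if G.Adj p q then 0 else 2 := by
    split_ifs with hadj
    · rw [Nat.le_zero, Finset.card_eq_zero, Finset.eq_empty_iff_forall_notMem]
      intro x hx
      obtain ⟨hxW, y, hxy, hcol⟩ := mem_colorEnds.1 hx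
      have h1 := hc (G.mem_edgeSet.2 hxy) (G.mem_edgeSet.2 hadj) hcol
      have h2 : x ∈ s(p, q) := h1 ▸ Sym2.mem_mk_left x y
      simp only [hWdef, Finset.mem_erase] at hxW
      simp only [Sym2.mem_iff] at h2
      tauto
    · exact card_colorEnds_le_two hc _ _
  have hm : missing G' W + 2 * (nonNbr G Finset.univ p).card +
      2 * (nonNbr G Finset.univ q).card + 18 ≤ 12 * k + if G.Adj p q then 0 else 4 := by
    have h1 : missing G' W ≤ missing G W + F.card := missing_avoidColor_le hc _ W
    have h2 := missing_erase G (Finset.mem_univ p)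
    have h3 : missing G (Finset.univ.erase p) =
        missing G W + 2 * (nonNbr G (Finset.univ.erase p) q).card :=
      missing_erase G (by simp [hpq.symm])
    have h4 := card_nonNbr_erase G (Finset.mem_univ p) hpq
    rw [G.adj_comm] at h4
    split_ifs at * <;> omega
  obtain ⟨J, hJI, hJ⟩ := Finset.exists_subset_card_eq hhI
  have hlow := le_missing_add G' (hJI.trans hIW) (d := 2 * k - 3 - h) fun x hx => hnon x (hJI hx)
  rw [hJ] at hlow
  rcases Nat.eq_zero_or_pos h with rfl | hpos
  · left
    obtain ⟨z, hz⟩ := Finset.card_pos.1 (show 0 < I.card by omega)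
    have hzW := hIW hz
    simp only [hWdef, Finset.mem_erase] at hzW
    exact ⟨z, hzW.2.1, hzW.1, Finset.card_eq_zero.1 (Nat.le_zero.1 (hI z hz))⟩
  right
  rcases Nat.lt_or_ge h 2 with hlt | hge
  · obtain rfl : h = 1 := by omega
    obtain ⟨z, hz⟩ := Finset.card_pos.1 (show 0 < I.card by omega)
    have hzW := hIW hz
    simp only [hWdef, Finset.mem_erase] at hzW
    have h1 := hnon z hz
    have h2 := card_nonNbr_avoidColor_le hc (c s(p, q)) W z
    have h3 := hWuniv z
    rw [← hG'] at h2
    have h4 : 2 * k ≤ (nonNbr G Finset.univ p).card + 5 ∧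
        2 * k ≤ (nonNbr G Finset.univ q).card + 5 := by
      rcases hD with hD | hD
      · have := hD z hzW.2.1 hzW.1
        omega
      · omega
    split_ifs at hm <;> omega
  obtain ⟨z, hzI, hzF⟩ : ∃ z ∈ I, z ∉ F := by
    by_contra! hcon
    have := Finset.card_le_card (show I ⊆ F from hcon)
    split_ifs at hFc <;> omega
  have hzW := hIW hzI
  have h1 := hnon z hzI
  rw [hG', nonNbr_avoidColor_of_notMem hzW hzF] at h1
  have h2 := hWuniv z
  simp only [hWdef, Finset.mem_erase] at hzW
  have h4 : 2 * k ≤ (nonNbr G Finset.univ p).card + 3 + h ∧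
      2 * k ≤ (nonNbr G Finset.univ q).card + 3 + h := by
    rcases hD with hD | hD
    · have := hD z hzW.2.1 hzW.1
      omega
    · omega
  obtain ⟨rfl, rfl⟩ : h = 5 ∧ k = 7 := by
    obtain ⟨t, rfl⟩ : ∃ t, k = h + 2 + t := ⟨k - h - 2, by omega⟩
    rw [show 2 * (h + 2 + t) - 3 - h = h + 1 + 2 * t by omega] at hlow
    have h5 : h * h + 4 * t * h ≤ 5 * h + 4 := by
      simp only [Nat.add_sub_cancel] at hlow
      split_ifs at hm <;> nlinarith
    have h6 : h + 4 * t ≤ 7 := by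
      by_contra! h7
      nlinarith
    have h8 : h ≤ 7 := by omega
    have h9 : t ≤ 1 := by omega
    interval_cases t <;> interval_cases h <;> simp_all
  refine ⟨rfl, by omega, by omega, ?_, I, hIW, by omega, hI⟩
  split_ifs at * <;> omega

end

end Rainbow

section Triple

open scoped Classical

variable {V : Type*} [Fintype V] {G : SimpleGraph V} {c : Sym2 V → ℕ} {k : ℕ}

/-- If `A` is the complement of a triple and spans a rainbow clique, then without a rainbow perfect
matching all edges from one vertex of the triple to `A` share the color of the opposite edge. -/
lemma color_eq_of_not_hasRainbowPerfectMatching (hk : 7 ≤ k) (hc : Set.InjOn c G.edgeSet)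
    (hno : ¬ HasRainbowPerfectMatching c Finset.univ) {A : Finset V} (hA : A.card + 3 = 2 * k)
    (hcl : ∀ x ∈ A, ∀ y ∈ A, x ≠ y → G.Adj x y) {p q r : V} (hpq : p ≠ q) (hpr : p ≠ r)
    (hqr : q ≠ r) (hpqr : ∀ x, x ∈ A ↔ x ≠ p ∧ x ≠ q ∧ x ≠ r) {w : V} (hw : w ∈ A) :
    c s(r, w) = c s(p, q) := by
  by_contra hne
  have hw' := (hpqr w).1 hw
  set T : Set (Sym2 V) := {e | e ∈ G.edgeSet ∧ c e ≠ c s(r, w) ∧ c e ≠ c s(p, q)} with hT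
  refine hno ⟨insert s(p, q) (insert s(r, w) T),
    injOn_insert_of_ne (injOn_insert_of_ne (hc.mono fun e he => he.1) fun e he => he.2.1) ?_, ?_⟩
  · rintro e (rfl | he)
    exacts [hne, he.2.2]
  refine .of_erase (Finset.mem_univ p) (Finset.mem_univ q) (by simp [hpq]) ?_
  refine .of_erase (p := r) (q := w) (by simp [hpr.symm, hqr.symm]) (by simp [hw'])
    (by simp [hw'.2.2.symm]) ?_
  have hU : (((Finset.univ.erase p).erase q).erase r).erase w = A.erase w := by
    congr 1
    ext x
    simp only [Finset.mem_erase, Finset.mem_univ, hpqr]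
    tauto
  rw [hU]
  refine hasPerfectMatchingOn_of_card_nonNbr_lt (m := k - 2)
    (by rw [Finset.card_erase_of_mem hw]; omega) fun x hx => ?_
  have hsub : nonNbr (SimpleGraph.fromEdgeSet (insert s(p, q) (insert s(r, w) T))) (A.erase w) x ⊆
      (Finset.univ.filter fun y => G.Adj x y ∧ c s(x, y) = c s(r, w)) ∪
      (Finset.univ.filter fun y => G.Adj x y ∧ c s(x, y) = c s(p, q)) := by
    intro y hy
    rw [mem_nonNbr] at hy
    have hadj := hcl x (Finset.mem_of_mem_erase hx) y (Finset.mem_of_mem_erase hy.1) hy.2.1.symm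
    have hnot : s(x, y) ∉ T := fun h => hy.2.2 <| by
      rw [SimpleGraph.fromEdgeSet_adj]
      exact ⟨Or.inr (Or.inr h), hy.2.1.symm⟩
    simp only [hT, Set.mem_ofPred_eq, SimpleGraph.mem_edgeSet] at hnot
    simp only [Finset.mem_union, Finset.mem_filter, Finset.mem_univ, true_and]
    tauto
  have h1 := Finset.card_le_card hsub
  have h2 := Finset.card_union_le
    (Finset.univ.filter fun y => G.Adj x y ∧ c s(x, y) = c s(r, w))
    (Finset.univ.filter fun y => G.Adj x y ∧ c s(x, y) = c s(p, q))
  have h3 := card_filter_color_le_one hc Finset.univ (c s(r, w)) x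
  have h4 := card_filter_color_le_one hc Finset.univ (c s(p, q)) x
  omega

lemma hasRainbowPerfectMatching_of_clique (hk : 7 ≤ k) (hc : Set.InjOn c G.edgeSet)
    {A : Finset V} (hA : A.card + 3 = 2 * k) (hcl : ∀ x ∈ A, ∀ y ∈ A, x ≠ y → G.Adj x y)
    {p q r : V} (hpq : p ≠ q) (hpr : p ≠ r) (hqr : q ≠ r)
    (hpqr : ∀ x, x ∈ A ↔ x ≠ p ∧ x ≠ q ∧ x ≠ r)
    (hp : ∃ e ∈ G.edgeSet, e = s(q, r) ∨ ∃ w ∈ A, e = s(p, w))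
    (hq : ∃ e ∈ G.edgeSet, e = s(p, r) ∨ ∃ w ∈ A, e = s(q, w))
    (hr : ∃ e ∈ G.edgeSet, e = s(p, q) ∨ ∃ w ∈ A, e = s(r, w)) :
    HasRainbowPerfectMatching c Finset.univ := by
  by_contra hno
  have hpqr' : ∀ x, x ∈ A ↔ x ≠ q ∧ x ≠ r ∧ x ≠ p := fun x => by rw [hpqr]; tauto
  have hpqr'' : ∀ x, x ∈ A ↔ x ≠ p ∧ x ≠ r ∧ x ≠ q := fun x => by rw [hpqr]; tauto
  have hcp : ∀ w ∈ A, c s(p, w) = c s(q, r) := fun w hw =>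
    color_eq_of_not_hasRainbowPerfectMatching hk hc hno hA hcl hqr hpq.symm hpr.symm hpqr' hw
  have hcq : ∀ w ∈ A, c s(q, w) = c s(p, r) := fun w hw =>
    color_eq_of_not_hasRainbowPerfectMatching hk hc hno hA hcl hpr hpq hqr.symm hpqr'' hw
  have hcr : ∀ w ∈ A, c s(r, w) = c s(p, q) := fun w hw =>
    color_eq_of_not_hasRainbowPerfectMatching hk hc hno hA hcl hpq hpr hqr hpqr hw
  have hpA : p ∉ A := fun h => ((hpqr p).1 h).1 rfl
  have hqA : q ∉ A := fun h => ((hpqr q).1 h).2.1 rfl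
  have hrA : r ∉ A := fun h => ((hpqr r).1 h).2.2 rfl
  obtain ⟨ep, hepG, hep⟩ := hp
  obtain ⟨eq, heqG, heq⟩ := hq
  obtain ⟨er, herG, her⟩ := hr
  have hcep : c ep = c s(q, r) := by
    rcases hep with rfl | ⟨w, hw, rfl⟩
    exacts [rfl, hcp w hw]
  have hceq : c eq = c s(p, r) := by
    rcases heq with rfl | ⟨w, hw, rfl⟩
    exacts [rfl, hcq w hw]
  have hcer : c er = c s(p, q) := by
    rcases her with rfl | ⟨w, hw, rfl⟩
    exacts [rfl, hcr w hw]
  have hpq' : c s(q, r) ≠ c s(p, r) := by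
    rw [← hcep, ← hceq]
    intro h
    have h' := hc hepG heqG h
    rcases hep with rfl | ⟨w, hw, rfl⟩ <;> rcases heq with rfl | ⟨w', hw', rfl⟩ <;>
      simp only [Sym2.eq_iff] at h' <;> grind
  have hpr' : c s(q, r) ≠ c s(p, q) := by
    rw [← hcep, ← hcer]
    intro h
    have h' := hc hepG herG h
    rcases hep with rfl | ⟨w, hw, rfl⟩ <;> rcases her with rfl | ⟨w', hw', rfl⟩ <;>
      simp only [Sym2.eq_iff] at h' <;> grind
  have hqr' : c s(p, r) ≠ c s(p, q) := by
    rw [← hceq, ← hcer]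
    intro h
    have h' := hc heqG herG h
    rcases heq with rfl | ⟨w, hw, rfl⟩ <;> rcases her with rfl | ⟨w', hw', rfl⟩ <;>
      simp only [Sym2.eq_iff] at h' <;> grind
  set T : Set (Sym2 V) := {e | e ∈ G.edgeSet ∧ ∀ v ∈ e, v ∈ A} with hT
  have hTp : ∀ e ∈ T, c e ≠ c s(q, r) := by
    rintro e ⟨heG, heA⟩ h
    have h' := hc heG hepG (h.trans hcep.symm)
    subst h'
    rcases hep with rfl | ⟨w, hw, rfl⟩
    exacts [hqA (heA q (by simp)), hpA (heA p (by simp))]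
  have hTq : ∀ e ∈ T, c e ≠ c s(p, r) := by
    rintro e ⟨heG, heA⟩ h
    have h' := hc heG heqG (h.trans hceq.symm)
    subst h'
    rcases heq with rfl | ⟨w, hw, rfl⟩
    exacts [hpA (heA p (by simp)), hqA (heA q (by simp))]
  have hTr : ∀ e ∈ T, c e ≠ c s(p, q) := by
    rintro e ⟨heG, heA⟩ h
    have h' := hc heG herG (h.trans hcer.symm)
    subst h'
    rcases her with rfl | ⟨w, hw, rfl⟩
    exacts [hpA (heA p (by simp)), hrA (heA r (by simp))]
  obtain ⟨w₁, w₂, w₃, h₁, h₂, h₃, h₁₂, h₁₃, h₂₃⟩ :=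
    Finset.two_lt_card_iff.1 (show 2 < A.card by omega)
  refine hno ⟨insert s(p, w₁) (insert s(q, w₂) (insert s(r, w₃) T)), ?_, ?_⟩
  · refine injOn_insert_of_ne (injOn_insert_of_ne (injOn_insert_of_ne
      (hc.mono fun e he => he.1) ?_) ?_) ?_
    · intro e he
      rw [hcr _ h₃]
      exact hTr e he
    · rintro e (rfl | he)
      · rw [hcr _ h₃, hcq _ h₂]
        exact hqr'.symm
      · rw [hcq _ h₂]
        exact hTq e he
    · rintro e (rfl | rfl | he)
      · rw [hcq _ h₂, hcp _ h₁]
        exact hpq'.symm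
      · rw [hcr _ h₃, hcp _ h₁]
        exact hpr'.symm
      · rw [hcp _ h₁]
        exact hTp e he
  have h₁' := (hpqr w₁).1 h₁
  have h₂' := (hpqr w₂).1 h₂
  have h₃' := (hpqr w₃).1 h₃
  refine .of_erase (Finset.mem_univ p) (Finset.mem_univ w₁) (by simp [h₁'.1.symm]) ?_
  refine .of_erase (p := q) (q := w₂) (by simp [hpq.symm, h₁'.2.1.symm])
    (by simp [h₂', h₁₂.symm]) (by simp [h₂'.2.1.symm]) ?_
  refine .of_erase (p := r) (q := w₃) (by simp [hpr.symm, hqr.symm, h₁'.2.2.symm, h₂'.2.2.symm])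
    (by simp [h₃', h₁₃.symm, h₂₃.symm]) (by simp [h₃'.2.2.symm]) ?_
  have hU : (((((Finset.univ.erase p).erase w₁).erase q).erase w₂).erase r).erase w₃ =
      ((A.erase w₁).erase w₂).erase w₃ := by
    ext x
    simp only [Finset.mem_erase, Finset.mem_univ, hpqr]
    tauto
  rw [hU]
  refine hasPerfectMatchingOn_of_complete (m := k - 3) ?_ fun x hx y hy hxy => ?_
  · rw [Finset.card_erase_of_mem (by simp [h₃, h₁₃.symm, h₂₃.symm]),
      Finset.card_erase_of_mem (by simp [h₂, h₁₂.symm]), Finset.card_erase_of_mem h₁]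
    omega
  · simp only [Finset.mem_erase] at hx hy
    rw [SimpleGraph.fromEdgeSet_adj]
    refine ⟨Or.inr (Or.inr (Or.inr ⟨hcl x hx.2.2.2 y hy.2.2.2 hxy, fun v hv => ?_⟩)), hxy⟩
    rcases Sym2.mem_iff.1 hv with rfl | rfl
    exacts [hx.2.2.2, hy.2.2.2]

/-- If three vertices have degree at most three, each of them sends to the remaining vertices at
most one edge, and none if the other two are adjacent. -/
lemma card_nbr_add_le_one_of_low_degree (hk : 7 ≤ k) (hV : Fintype.card V = 2 * k)
    (hc : Set.InjOn c G.edgeSet) (hmiss : missing G Finset.univ + 18 ≤ 12 * k)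
    (hno : ¬ HasRainbowPerfectMatching c Finset.univ) {p q r : V} (hpq : p ≠ q) (hpr : p ≠ r)
    (hqr : q ≠ r) (hp : 2 * k ≤ (nonNbr G Finset.univ p).card + 4)
    (hq : 2 * k ≤ (nonNbr G Finset.univ q).card + 4)
    (hr : 2 * k ≤ (nonNbr G Finset.univ r).card + 4) {A : Finset V}
    (hA : ∀ x, x ∈ A ↔ x ≠ p ∧ x ≠ q ∧ x ≠ r) :
    (nbr G A r).card + (if G.Adj p q then 1 else 0) ≤ 1 := by
  rcases isolated_or_exceptional hk hV hc hmiss hno hpq (Or.inr ⟨hp, hq⟩) with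
    ⟨z, hzp, hzq, hz⟩ | ⟨rfl, -, -, h, -⟩
  swap
  · split_ifs at h <;> omega
  have hz' : ∀ y, y ≠ p → y ≠ q → G.Adj z y → c s(z, y) = c s(p, q) := by
    intro y hyp hyq hadj
    by_contra hne
    have : y ∈ nbr (avoidColor G c (c s(p, q))) ((Finset.univ.erase p).erase q) z := by
      rw [mem_nbr, avoidColor_adj]
      exact ⟨by simp [hyp, hyq], hadj, hne⟩
    simp [hz] at this
  have hzr : z = r := by
    by_contra hzr
    have h1 : nbr G Finset.univ z ⊆ insert p (insert q
        (Finset.univ.filter fun y => G.Adj z y ∧ c s(z, y) = c s(p, q))) := by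
      intro y hy
      have hy := (mem_nbr.1 hy).2
      have := hz' y
      simp only [Finset.mem_insert, Finset.mem_filter, Finset.mem_univ, true_and]
      tauto
    have h2 := Finset.card_le_card h1
    have h3 := Finset.card_insert_le p (insert q
        (Finset.univ.filter fun y => G.Adj z y ∧ c s(z, y) = c s(p, q)))
    have h4 := Finset.card_insert_le q
        (Finset.univ.filter fun y => G.Adj z y ∧ c s(z, y) = c s(p, q))
    have h5 := card_filter_color_le_one hc Finset.univ (c s(p, q)) z
    have h6 := card_nbr_add_card_nonNbr G (Finset.mem_univ z)
    rw [Finset.card_univ, hV] at h6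
    have h7 := le_missing_add G (Finset.subset_univ {p, q, r, z}) (d := 2 * k - 4) fun x hx => by
      simp only [Finset.mem_insert, Finset.mem_singleton] at hx
      rcases hx with rfl | rfl | rfl | rfl <;> omega
    have h8 : ({p, q, r, z} : Finset V).card = 4 := by
      rw [Finset.card_insert_of_notMem, Finset.card_insert_of_notMem,
        Finset.card_insert_of_notMem, Finset.card_singleton] <;>
      simp [hpq, hpr, hqr, Ne.symm hzp, Ne.symm hzq, Ne.symm hzr]
    rw [h8] at h7
    omega
  subst hzr
  split_ifs with hadj
  · have : nbr G A z = ∅ := by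
      rw [Finset.eq_empty_iff_forall_notMem]
      intro y hy
      obtain ⟨hyA, hy⟩ := mem_nbr.1 hy
      have hyA := (hA y).1 hyA
      have h1 := hc (G.mem_edgeSet.2 hy) (G.mem_edgeSet.2 hadj) (hz' y hyA.1 hyA.2.1 hy)
      have h2 : z ∈ s(p, q) := h1 ▸ Sym2.mem_mk_left z y
      rw [Sym2.mem_iff] at h2
      tauto
    simp [this]
  · refine (Finset.card_le_card fun y hy => ?_).trans
      (card_filter_color_le_one hc A (c s(p, q)) z)
    obtain ⟨hyA, hy⟩ := mem_nbr.1 hy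
    have hyA' := (hA y).1 hyA
    exact Finset.mem_filter.2 ⟨hyA, hy, hz' y hyA'.1 hyA'.2.1 hy⟩

lemma hasRainbowPerfectMatching_of_low_degree (hk : 7 ≤ k) (hV : Fintype.card V = 2 * k)
    (hc : Set.InjOn c G.edgeSet) (hmiss : missing G Finset.univ + 18 ≤ 12 * k)
    {p q r : V} (hpq : p ≠ q) (hpr : p ≠ r) (hqr : q ≠ r)
    (hp : 2 * k ≤ (nonNbr G Finset.univ p).card + 4)
    (hq : 2 * k ≤ (nonNbr G Finset.univ q).card + 4)
    (hr : 2 * k ≤ (nonNbr G Finset.univ r).card + 4) :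
    HasRainbowPerfectMatching c Finset.univ := by
  by_contra hno
  obtain ⟨A, hA⟩ : ∃ A, A = ((Finset.univ.erase p).erase q).erase r := ⟨_, rfl⟩
  have hmem : ∀ x, x ∈ A ↔ x ≠ p ∧ x ≠ q ∧ x ≠ r := fun x => by
    rw [hA]
    simp only [Finset.mem_erase, Finset.mem_univ]
    tauto
  have hqp : q ∈ Finset.univ.erase p := by simp [hpq.symm]
  have hrp : r ∈ Finset.univ.erase p := by simp [hpr.symm]
  have hrpq : r ∈ (Finset.univ.erase p).erase q := by simp [hpr.symm, hqr.symm]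
  have hcard : A.card + 3 = 2 * k := by
    have h1 := card_erase_erase hV hpq
    have h2 := Finset.card_erase_add_one hrpq
    rw [← hA] at h2
    omega
  have hr1 := card_nbr_add_le_one_of_low_degree hk hV hc hmiss hno hpq hpr hqr hp hq hr hmem
  have hq1 := card_nbr_add_le_one_of_low_degree hk hV hc hmiss hno hpr hpq hqr.symm hp hr hq
    (A := A) fun x => by rw [hmem]; tauto
  have hp1 := card_nbr_add_le_one_of_low_degree hk hV hc hmiss hno hqr hpq.symm hpr.symm hq hr hp
    (A := A) fun x => by rw [hmem]; tauto
  have hsplit : ∀ x, x ∉ A → (nbr G A x).card + (nonNbr G A x).card + 3 = 2 * k := by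
    intro x hx
    have h1 := card_nbr_add_card_nonNbr G (Finset.mem_insert_self x A)
    have h2 : nbr G (insert x A) x = nbr G A x := by
      ext y
      simp only [mem_nbr, Finset.mem_insert]
      refine ⟨fun h => ⟨h.1.resolve_left h.2.ne', h.2⟩, fun h => ⟨Or.inr h.1, h.2⟩⟩
    have h3 : nonNbr G (insert x A) x = nonNbr G A x := by
      ext y
      simp only [mem_nonNbr, Finset.mem_insert]
      tauto
    rw [h2, h3, Finset.card_insert_of_notMem hx] at h1
    omega
  have hsp := hsplit p fun h => ((hmem p).1 h).1 rfl
  have hsq := hsplit q fun h => ((hmem q).1 h).2.1 rfl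
  have hsr := hsplit r fun h => ((hmem r).1 h).2.2 rfl
  have e1 := missing_erase G (Finset.mem_univ p)
  have e2 := missing_erase G hqp
  have e3 := missing_erase G hrpq
  have f1 := card_nonNbr_erase G hrpq hpr.symm
  have f2 := card_nonNbr_erase G hrpq hqr.symm
  have g0 : nonNbr G Finset.univ p = nonNbr G (Finset.univ.erase p) p := by
    ext y; simp only [mem_nonNbr, Finset.mem_erase, Finset.mem_univ]; tauto
  have g1 := card_nonNbr_erase G hqp hpq.symm
  have g2 : nonNbr G (Finset.univ.erase p) q = nonNbr G ((Finset.univ.erase p).erase q) q := by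
    ext y; simp only [mem_nonNbr, Finset.mem_erase, Finset.mem_univ]; tauto
  have g3 : nonNbr G ((Finset.univ.erase p).erase q) r = nonNbr G A r := by
    ext y; simp only [hA, mem_nonNbr, Finset.mem_erase, Finset.mem_univ]; tauto
  rw [← g0] at g1
  rw [← g2] at f2
  rw [g3, ← hA] at e3
  rw [← hA] at f1 f2
  clear hA g0 g2 g3
  have key : missing G A = 0 ∧
      (nbr G A r).card + (if G.Adj p q then 1 else 0) = 1 ∧
      (nbr G A q).card + (if G.Adj p r then 1 else 0) = 1 ∧
      (nbr G A p).card + (if G.Adj q r then 1 else 0) = 1 := by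
    split_ifs at * <;> omega
  have hedge : ∀ x y z, (nbr G A z).card + (if G.Adj x y then 1 else 0) = 1 →
      ∃ e ∈ G.edgeSet, e = s(x, y) ∨ ∃ w ∈ A, e = s(z, w) := by
    intro x y z h
    split_ifs at h with hxy
    · exact ⟨s(x, y), hxy, Or.inl rfl⟩
    · obtain ⟨w, hw⟩ := Finset.card_pos.1 (show 0 < (nbr G A z).card by omega)
      exact ⟨s(z, w), (mem_nbr.1 hw).2, Or.inr ⟨w, (mem_nbr.1 hw).1, rfl⟩⟩
  refine hno (hasRainbowPerfectMatching_of_clique hk hc hcard (fun x hx y hy hxy => ?_) hpq hpr hqr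
    hmem (hedge _ _ _ key.2.2.2) (hedge _ _ _ key.2.2.1) (hedge _ _ _ key.2.1))
  by_contra hadj
  have h1 := Finset.sum_eq_zero_iff.1 key.1 x hx
  rw [Finset.card_eq_zero] at h1
  have h2 : y ∈ nonNbr G A x := mem_nonNbr.2 ⟨hy, hxy.symm, hadj⟩
  simp [h1] at h2

end Triple

section Main

open scoped Classical

variable {V : Type*} [Fintype V]

/-- The exceptional case on 14 vertices: some eight vertices form an independent set that is
completely joined to the other six. -/
lemma hasRainbowPerfectMatching_of_exceptional {G : SimpleGraph V} {c : Sym2 V → ℕ}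
    (hV : Fintype.card V = 14) (hc : Set.InjOn c G.edgeSet)
    (hmiss : missing G Finset.univ ≤ 66) {p q : V}
    (hpq : p ≠ q)
    (hmax : ∀ w, w ≠ p → w ≠ q →
        (nonNbr G Finset.univ w).card ≤ (nonNbr G Finset.univ p).card ∧
        (nonNbr G Finset.univ w).card ≤ (nonNbr G Finset.univ q).card)
    (hp : 6 ≤ (nonNbr G Finset.univ p).card) (hq : 6 ≤ (nonNbr G Finset.univ q).card)
    (hsum : (nonNbr G Finset.univ p).card + (nonNbr G Finset.univ q).card ≤ 14) :
    HasRainbowPerfectMatching c Finset.univ := by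
  by_contra hno
  have hno' : ¬ HasPerfectMatchingOn G Finset.univ := fun h =>
    hno ⟨G.edgeSet, hc, by rwa [SimpleGraph.fromEdgeSet_edgeSet]⟩
  obtain ⟨h, I, -, hh, hhI, hhI', hI⟩ :=
    exists_low_degree_of_not_hasPerfectMatchingOn (m := 7) (by rw [Finset.card_univ, hV]) hno'
  have hdeg : ∀ x, (nbr G Finset.univ x).card + (nonNbr G Finset.univ x).card + 1 = 14 := fun x => by
    rw [card_nbr_add_card_nonNbr G (Finset.mem_univ x), Finset.card_univ, hV]
  have hle : ∀ x, (nonNbr G Finset.univ x).card ≤ 8 := fun x => by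
    by_cases hxp : x = p
    · subst hxp; omega
    by_cases hxq : x = q
    · subst hxq; omega
    have := hmax x hxp hxq
    omega
  obtain ⟨w₀, hw₀⟩ := Finset.card_pos.1 (show 0 < I.card by omega)
  have hh5 : 5 ≤ h := by
    have h1 := hI w₀ hw₀
    have h2 := hdeg w₀
    have h3 := hle w₀
    omega
  obtain ⟨w, hw, hwp, hwq⟩ : ∃ w ∈ I, w ≠ p ∧ w ≠ q := by
    by_contra! hcon
    have h1 : I ⊆ {p, q} := fun x hx => by
      simp only [Finset.mem_insert, Finset.mem_singleton]
      have := hcon x hx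
      tauto
    have h2 := (Finset.card_le_card h1).trans Finset.card_le_two
    omega
  have hw1 := hI w hw
  have hw2 := hdeg w
  have hw3 := hmax w hwp hwq
  obtain rfl : h = 6 := by omega
  have hle7 : ∀ x, (nonNbr G Finset.univ x).card ≤ 7 := fun x => by
    by_cases hxp : x = p
    · subst hxp; omega
    by_cases hxq : x = q
    · subst hxq; omega
    have := hmax x hxp hxq
    omega
  have hI7 : ∀ x ∈ I, (nonNbr G Finset.univ x).card = 7 := fun x hx => by
    have h1 := hI x hx
    have h2 := hdeg x
    have h3 := hle7 x
    omega
  have hpair : ∀ a ∈ I, ∀ b ∈ I, a ≠ b → ¬ G.Adj a b ∧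
      ∃ J ⊆ (Finset.univ.erase a).erase b, 7 ≤ J.card ∧
        ∀ x ∈ J, (nbr (avoidColor G c (c s(a, b)))
          ((Finset.univ.erase a).erase b) x).card ≤ 5 := by
    intro a ha b hb hab
    have h1 := hI7 a ha
    have h2 := hI7 b hb
    rcases isolated_or_exceptional (k := 7) le_rfl hV hc (by omega) hno hab
      (Or.inl fun w _ _ => by rw [h1, h2]; exact ⟨hle7 w, hle7 w⟩) with
      ⟨z, hza, hzb, hz⟩ | ⟨-, -, -, h3, h4⟩
    · have hzU : z ∈ (Finset.univ.erase a).erase b := by simp [hza, hzb]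
      have h3 := card_nonNbr_avoidColor_le hc (c s(a, b)) ((Finset.univ.erase a).erase b) z
      have h4 := card_nbr_add_card_nonNbr (avoidColor G c (c s(a, b))) hzU
      rw [hz, card_erase_erase (k := 7) hV hab] at h4
      have h5 : (nonNbr G ((Finset.univ.erase a).erase b) z).card ≤
          (nonNbr G Finset.univ z).card :=
        Finset.card_le_card (Finset.filter_subset_filter _ (Finset.subset_univ _))
      have h6 := hle7 z
      simp only [Finset.card_empty] at h4
      omega
    · refine ⟨fun hadj => ?_, h4⟩
      rw [if_pos hadj] at h3
      omega
  have hnbrI : ∀ x ∈ I, nbr G Finset.univ x = Iᶜ := fun x hx => by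
    refine Finset.eq_of_subset_of_card_le (fun y hy => ?_) ?_
    · rw [Finset.mem_compl]
      intro hyI
      have hadj := (mem_nbr.1 hy).2
      exact (hpair x hx y hyI hadj.ne).1 hadj
    · have h1 := hdeg x
      have h2 := hI7 x hx
      have h3 := hhI' rfl
      rw [Finset.card_compl, hV]
      omega
  have hI8 : I.card = 8 := by
    have h1 := hnbrI w hw
    have h2 := congrArg Finset.card h1
    rw [Finset.card_compl, hV] at h2
    have h3 := hI7 w hw
    omega
  obtain ⟨a, ha, b, hb, hab⟩ := Finset.one_lt_card.1 (show 1 < I.card by omega)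
  obtain ⟨-, J, hJW, hJ7, hJ⟩ := hpair a ha b hb hab
  have hsub : J ⊆ colorEnds G c (c s(a, b)) ((Finset.univ.erase a).erase b) := by
    intro x hx
    by_contra hxF
    have h1 := hJ x hx
    rw [nbr_avoidColor_of_notMem (hJW hx) hxF] at h1
    have h2 : 6 ≤ (nbr G ((Finset.univ.erase a).erase b) x).card := by
      by_cases hxI : x ∈ I
      · have h3 : Iᶜ ⊆ nbr G ((Finset.univ.erase a).erase b) x := fun y hy => by
          have h4 := hy
          rw [← hnbrI x hxI] at h4
          rw [Finset.mem_compl] at hy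
          refine mem_nbr.2 ⟨?_, (mem_nbr.1 h4).2⟩
          simp only [Finset.mem_erase, Finset.mem_univ, and_true]
          exact ⟨fun e => hy (e ▸ hb), fun e => hy (e ▸ ha)⟩
        have h4 := Finset.card_le_card h3
        rw [Finset.card_compl, hV, hI8] at h4
        exact h4
      · have h3 : (I.erase a).erase b ⊆ nbr G ((Finset.univ.erase a).erase b) x := fun y hy => by
          simp only [Finset.mem_erase] at hy
          have h4 : x ∈ nbr G Finset.univ y := by
            rw [hnbrI y hy.2.2]
            exact Finset.mem_compl.2 hxI
          refine mem_nbr.2 ⟨?_, (mem_nbr.1 h4).2.symm⟩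
          simp [hy.1, hy.2.1]
        have h4 := Finset.card_le_card h3
        rw [Finset.card_erase_of_mem (Finset.mem_erase.2 ⟨hab.symm, hb⟩),
          Finset.card_erase_of_mem ha, hI8] at h4
        exact h4
    omega
  have h1 := Finset.card_le_card hsub
  have h2 := card_colorEnds_le_two hc (c s(a, b)) ((Finset.univ.erase a).erase b)
  omega

lemma hasRainbowPerfectMatching_of_missing_le {G : SimpleGraph V} {c : Sym2 V → ℕ} {k : ℕ}
    (hk : 7 ≤ k) (hV : Fintype.card V = 2 * k) (hc : Set.InjOn c G.edgeSet)
    (hmiss : missing G Finset.univ + 18 ≤ 12 * k) :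
    HasRainbowPerfectMatching c Finset.univ := by
  have hcard : (Finset.univ : Finset V).card = 2 * k := hV
  obtain ⟨p, hp, hpmax⟩ := Finset.exists_max_image Finset.univ
    (fun x => (nonNbr G Finset.univ x).card) (Finset.card_pos.1 (show 0 < Finset.univ.card by omega))
  obtain ⟨q, hq, hqmax⟩ := Finset.exists_max_image (Finset.univ.erase p)
    (fun x => (nonNbr G Finset.univ x).card)
    (Finset.card_pos.1 (by rw [Finset.card_erase_of_mem hp]; omega))
  have hpq : p ≠ q := (Finset.ne_of_mem_erase hq).symm
  have hmax : ∀ w, w ≠ p → w ≠ q →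
      (nonNbr G Finset.univ w).card ≤ (nonNbr G Finset.univ p).card ∧
      (nonNbr G Finset.univ w).card ≤ (nonNbr G Finset.univ q).card := fun w hwp _ =>
    ⟨hpmax w (Finset.mem_univ w), hqmax w (Finset.mem_erase.2 ⟨hwp, Finset.mem_univ w⟩)⟩
  by_contra hno
  rcases isolated_or_exceptional hk hV hc hmiss hno hpq (Or.inl hmax) with
    ⟨z, hzp, hzq, hz⟩ | ⟨rfl, h1, h2, h3, -⟩
  · have hzU : z ∈ (Finset.univ.erase p).erase q := by simp [hzp, hzq]
    have h3 := card_nonNbr_avoidColor_le hc (c s(p, q)) ((Finset.univ.erase p).erase q) z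
    have h4 := card_nbr_add_card_nonNbr (avoidColor G c (c s(p, q))) hzU
    rw [hz, card_erase_erase hV hpq, Finset.card_empty] at h4
    have h5 : (nonNbr G ((Finset.univ.erase p).erase q) z).card ≤
        (nonNbr G Finset.univ z).card :=
      Finset.card_le_card (Finset.filter_subset_filter _ (Finset.subset_univ _))
    have h6 := hmax z hzp hzq
    exact hno (hasRainbowPerfectMatching_of_low_degree hk hV hc hmiss hpq hzp.symm hzq.symm
      (by omega) (by omega) (by omega))
  · refine hno (hasRainbowPerfectMatching_of_exceptional hV hc (by omega) hpq hmax h1 h2 ?_)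
    split_ifs at h3 <;> omega

/-- One edge of every color forms a graph whose number of edges is the number of colors. -/
lemma exists_rainbow_subgraph (c : Sym2 V → ℕ) :
    ∃ G : SimpleGraph V, Set.InjOn c G.edgeSet ∧
      missing G Finset.univ + 2 * ((⊤ : SimpleGraph V).edgeFinset.image c).card =
        Fintype.card V * (Fintype.card V - 1) := by
  obtain ⟨T, hT, hTinj, hTc⟩ := Finset.exists_subset_injOn_image_eq_of_surjOn (f := c)
    (↑(⊤ : SimpleGraph V).edgeFinset) ((⊤ : SimpleGraph V).edgeFinset.image c)
    (by rw [Finset.coe_image]; exact Set.surjOn_image c _)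
  have hedge : (SimpleGraph.fromEdgeSet (T : Set (Sym2 V))).edgeSet = T := by
    rw [SimpleGraph.edgeSet_fromEdgeSet, sdiff_eq_left, Set.disjoint_left]
    intro e he
    simpa using hT he
  refine ⟨SimpleGraph.fromEdgeSet T, by rwa [hedge], ?_⟩
  set G := SimpleGraph.fromEdgeSet (T : Set (Sym2 V)) with hG
  have hcardT : ((⊤ : SimpleGraph V).edgeFinset.image c).card = G.edgeFinset.card := by
    rw [← hTc, Finset.card_image_of_injOn hTinj]
    congr 1
    rw [← Finset.coe_inj, SimpleGraph.coe_edgeFinset, hedge]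
  have hnbr : ∀ x, (nbr G Finset.univ x).card = G.degree x := fun x => by
    rw [← SimpleGraph.card_neighborFinset_eq_degree]
    congr 1
    ext y
    simp [mem_nbr]
  have hsum : ∑ x, G.degree x = 2 * G.edgeFinset.card := by
    convert G.sum_degrees_eq_twice_card_edges
  rw [hcardT, ← hsum, missing, ← Finset.sum_add_distrib,
    Finset.sum_congr rfl (g := fun _ => Fintype.card V - 1), Finset.sum_const, Finset.card_univ,
    smul_eq_mul]
  intro x _
  have := card_nbr_add_card_nonNbr G (Finset.mem_univ x)
  rw [hnbr, Finset.card_univ] at this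
  omega

end Main

lemma HasRainbowPerfectMatching.hasRainbowMatching {k : ℕ} {c : Sym2 (Fin (2 * k)) → ℕ}
    (h : HasRainbowPerfectMatching c Finset.univ) : HasRainbowMatching c k := by
  obtain ⟨S, hS, σ, hσ⟩ := h
  simp only [Finset.mem_univ, true_and, forall_const, SimpleGraph.fromEdgeSet_adj] at hσ
  have heq : ∀ x y, s(x, σ x) = s(y, σ y) ↔ y ∈ ({x, σ x} : Finset (Fin (2 * k))) := by
    intro x y
    rw [Sym2.eq_iff, Finset.mem_insert, Finset.mem_singleton]
    constructor
    · rintro (⟨h, -⟩ | ⟨-, h⟩)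
      exacts [Or.inl h.symm, Or.inr h.symm]
    · rintro (rfl | rfl)
      · simp
      · simp [(hσ x).1]
  refine ⟨Finset.univ.image fun x => s(x, σ x), ?_, ?_, ?_, hS.mono ?_⟩
  · have h1 := Finset.card_eq_sum_card_image (fun x => s(x, σ x))
      (Finset.univ : Finset (Fin (2 * k)))
    rw [Finset.sum_congr rfl (g := fun _ => 2), Finset.sum_const, Finset.card_univ,
      Fintype.card_fin, smul_eq_mul] at h1
    · omega
    · intro e he
      obtain ⟨x, -, rfl⟩ := Finset.mem_image.1 he
      refine Eq.trans ?_ (Finset.card_pair (hσ x).2.2)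
      congr 1
      ext y
      rw [Finset.mem_filter, eq_comm, heq]
      simp
  · intro e he
    obtain ⟨x, -, rfl⟩ := Finset.mem_image.1 he
    exact (hσ x).2.2
  · intro e he f hf hef v hve hvf
    obtain ⟨x, -, rfl⟩ := Finset.mem_image.1 he
    obtain ⟨y, -, rfl⟩ := Finset.mem_image.1 hf
    refine hef (((heq x v).2 ?_).trans ((heq y v).2 ?_).symm)
    · simpa using hve
    · simpa using hvf
  · intro e he
    obtain ⟨x, -, rfl⟩ := Finset.mem_image.1 he
    exact (hσ x).2.1

/-- Main theorem, case `n = 2k` with `k ≥ 7`, upper bound: every edge coloring of `K_{2k}`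
using at least `C(2k-3,2) + 3` colors contains a rainbow matching of size `k`. -/
theorem rb_main_n_eq_2k (k : ℕ) (hk : 7 ≤ k) (c : Sym2 (Fin (2 * k)) → ℕ)
    (hc : Nat.choose (2 * k - 3) 2 + 3 ≤ numColors c) :
    HasRainbowMatching c k := by
  obtain ⟨G, hG, hmiss⟩ := exists_rainbow_subgraph c
  refine (hasRainbowPerfectMatching_of_missing_le (G := G) hk (Fintype.card_fin _) hG
    ?_).hasRainbowMatching
  have h1 : missing G Finset.univ + 2 * numColors c = 2 * k * (2 * k - 1) := by
    rw [Fintype.card_fin] at hmiss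
    rw [← hmiss, numColors]
    congr!
  have h2 := Nat.choose_two_right (2 * k - 3)
  obtain ⟨j, hj⟩ := Nat.even_mul_pred_self (2 * k - 3)
  obtain ⟨t, rfl⟩ : ∃ t, k = t + 2 := ⟨k - 2, by omega⟩
  rw [show 2 * (t + 2) - 3 = 2 * t + 1 by omega] at hc h2 hj
  rw [Nat.add_sub_cancel] at hj h2
  rw [show 2 * (t + 2) - 1 = 2 * t + 3 by omega] at h1
  have h3 : 2 * numColors c ≥ (2 * t + 1) * (2 * t) + 6 := by omega
  nlinarith
end

section
/- (Lower bound construction for n = 2k) Let k ≥ 3. There exists an edge coloring of the complete graph K_{2k} using exactly (2k-3 choose 2) + 2 colors that contains no rainbow matching of size k. (Explicitly: fix a set H of 2k-3 vertices and let the remaining three vertices be a₁, a₂, a₃; color the edges inside H with (2k-3 choose 2) pairwise distinct colors, color a₁a₂ and all edges from a₃ to H with one extra color, and color a₁a₃, a₂a₃ and all edges from a₁ and a₂ to H with a second extra color.) -/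
open Finset in
/-- A matching of `K_{2k}` with `k` edges covers every vertex. -/
theorem exists_mem_of_pairwise_disjoint_of_card {k : ℕ} {s : Finset (Sym2 (Fin (2 * k)))}
    (hs : s.card = k) (hdiag : ∀ e ∈ s, ¬ e.IsDiag)
    (hdisj : (s : Set (Sym2 (Fin (2 * k)))).Pairwise fun e f => ∀ v, v ∈ e → v ∉ f)
    (v : Fin (2 * k)) : ∃ e ∈ s, v ∈ e := by
  have hcard : (s.biUnion Sym2.toFinset).card = 2 * k := by
    rw [card_biUnion]
    · rw [sum_congr rfl fun e he => Sym2.card_toFinset_of_not_isDiag e (hdiag e he)]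
      simp [hs, mul_comm]
    · intro e he f hf hef
      rw [Function.onFun, disjoint_left]
      simpa using hdisj he hf hef
  have huniv : s.biUnion Sym2.toFinset = univ := by
    rw [← card_eq_iff_eq_univ, hcard, Fintype.card_fin]
  have hv := mem_univ v
  rw [← huniv] at hv
  simpa using hv

/-- The edge coloring that uses the color `0` on `a₁a₂` and on the edges at `a₃` avoiding
`a₁, a₂`, the color `1` on the other edges meeting `{a₁, a₂}`, and `f e + 2` on the edges `e`
avoiding all three vertices. -/
def threeVertexColoring {V : Type*} [DecidableEq V] (a₁ a₂ a₃ : V) (f : Sym2 V → ℕ)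
    (e : Sym2 V) : ℕ :=
  if a₁ ∈ e then (if a₂ ∈ e then 0 else 1)
  else if a₂ ∈ e then 1
  else if a₃ ∈ e then 0
  else f e + 2

theorem not_hasRainbowMatching_threeVertexColoring {k : ℕ} {a₁ a₂ a₃ : Fin (2 * k)}
    (h₁₂ : a₁ ≠ a₂) (h₁₃ : a₁ ≠ a₃) (h₂₃ : a₂ ≠ a₃) (f : Sym2 (Fin (2 * k)) → ℕ) :
    ¬ HasRainbowMatching (threeVertexColoring a₁ a₂ a₃ f) k := by
  rintro ⟨s, hs, hdiag, hdisj, hinj⟩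
  have hcover := exists_mem_of_pairwise_disjoint_of_card hs hdiag hdisj
  obtain ⟨e₁, he₁, h₁⟩ := hcover a₁
  obtain ⟨e₂, he₂, h₂⟩ := hcover a₂
  obtain ⟨e₃, he₃, h₃⟩ := hcover a₃
  by_cases h : e₁ = e₂
  · subst h
    have he : e₁ = s(a₁, a₂) := (Sym2.mem_and_mem_iff h₁₂).1 ⟨h₁, h₂⟩
    have hne : e₁ ≠ e₃ := by
      rintro rfl
      rw [he, Sym2.mem_iff] at h₃
      exact h₃.elim h₁₃.symm h₂₃.symm
    refine hne (hinj he₁ he₃ ?_)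
    simp [threeVertexColoring, h₁, h₂, h₃, hdisj he₁ he₃ hne _ h₁, hdisj he₁ he₃ hne _ h₂]
  · refine h (hinj he₁ he₂ ?_)
    simp [threeVertexColoring, h₁, h₂, hdisj he₁ he₂ h _ h₁,
      hdisj he₂ he₁ (Ne.symm h) _ h₂]

open Finset in
theorem numColors_threeVertexColoring {n : ℕ} {a₁ a₂ a₃ : Fin n}
    (h₁₂ : a₁ ≠ a₂) (h₁₃ : a₁ ≠ a₃) (h₂₃ : a₂ ≠ a₃) {f : Sym2 (Fin n) → ℕ}
    (hf : Function.Injective f) :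
    numColors (threeVertexColoring a₁ a₂ a₃ f) = (n - 3).choose 2 + 2 := by
  set H : Finset (Fin n) := ({a₁, a₂, a₃} : Finset (Fin n))ᶜ with hH
  have hHcard : H.card = n - 3 := by
    rw [hH, card_compl, Fintype.card_fin, card_eq_three.2 ⟨a₁, a₂, a₃, h₁₂, h₁₃, h₂₃, rfl⟩]
  have hHmem (x : Fin n) : x ∈ H ↔ a₁ ≠ x ∧ a₂ ≠ x ∧ a₃ ≠ x := by
    simp [hH, eq_comm]
  clear_value H
  have himage : ((⊤ : SimpleGraph (Fin n)).edgeFinset).image (threeVertexColoring a₁ a₂ a₃ f) =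
      {0, 1} ∪ (H.offDiag.image Sym2.mk.uncurry).image (fun e => f e + 2) := by
    ext m
    simp only [mem_image, mem_union, SimpleGraph.mem_edgeFinset]
    constructor
    · rintro ⟨e, he, rfl⟩
      by_cases h : a₁ ∈ e ∨ a₂ ∈ e ∨ a₃ ∈ e
      · left
        unfold threeVertexColoring
        split_ifs <;> simp_all
      · right
        push Not at h
        refine ⟨e, ?_, by simp [threeVertexColoring, h]⟩
        induction e with | _ x y
        refine ⟨(x, y), ?_, rfl⟩
        simp_all
    · rintro (hm | ⟨e, ⟨⟨x, y⟩, hxy, rfl⟩, rfl⟩)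
      · rcases mem_insert.1 hm with rfl | hm
        · exact ⟨s(a₁, a₂), by simpa using h₁₂, by simp [threeVertexColoring]⟩
        · rw [mem_singleton.1 hm]
          exact ⟨s(a₁, a₃), by simpa using h₁₃, by simp [threeVertexColoring, h₁₂.symm, h₂₃]⟩
      · refine ⟨s(x, y), ?_, ?_⟩
        · simp_all
        · simp_all [threeVertexColoring]
  have hdisj : Disjoint ({0, 1} : Finset ℕ)
      ((H.offDiag.image Sym2.mk.uncurry).image (fun e => f e + 2)) := by
    rw [disjoint_left]
    intro m hm hm'
    obtain ⟨e, -, rfl⟩ := mem_image.1 hm'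
    simp at hm
  rw [numColors, himage, card_union_of_disjoint hdisj,
    card_image_of_injective (f := fun e => f e + 2) _ ((add_left_injective 2).comp hf), Sym2.card_image_offDiag, hHcard,
    card_pair zero_ne_one, add_comm]

/-- Lower bound construction for `n = 2k`: for `k ≥ 3` there is an edge coloring of
`K_{2k}` using exactly `C(2k-3,2) + 2` colors with no rainbow matching of size `k`. -/
theorem rb_lower_construction_2k (k : ℕ) (hk : 3 ≤ k) :
    ∃ c : Sym2 (Fin (2 * k)) → ℕ,
      numColors c = Nat.choose (2 * k - 3) 2 + 2 ∧
      ¬ HasRainbowMatching c k := by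
  obtain ⟨f, hf⟩ := Countable.exists_injective_nat (Sym2 (Fin (2 * k)))
  have h₁₂ : (⟨0, by lia⟩ : Fin (2 * k)) ≠ ⟨1, by lia⟩ := by simp
  have h₁₃ : (⟨0, by lia⟩ : Fin (2 * k)) ≠ ⟨2, by lia⟩ := by simp
  have h₂₃ : (⟨1, by lia⟩ : Fin (2 * k)) ≠ ⟨2, by lia⟩ := by simp
  exact ⟨_, numColors_threeVertexColoring h₁₂ h₁₃ h₂₃ hf,
    not_hasRainbowMatching_threeVertexColoring h₁₂ h₁₃ h₂₃ f⟩
end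

section
/- (Claim 1) Let k ≥ 3 and n ≥ 2k, and let c be an edge coloring of the complete graph K_n. Suppose there exist disjoint vertex sets U and W with |U| = 2k-3 and |W| = 3 such that the (2k-3 choose 2) + 3 edges of K_n lying inside U or inside W have pairwise distinct colors under c, and every edge of K_n receives the same color as some edge lying inside U or inside W. Then K_n contains a rainbow matching of size k. -/
/-- The set of edges of the complete graph on `Fin n` lying inside the vertex set `U`. -/
def edgesInside {n : ℕ} (U : Finset (Fin n)) : Set (Sym2 (Fin n)) :=
  {e | ¬ e.IsDiag ∧ ∀ v ∈ e, v ∈ U}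

/-- `M` is a set of `m` pairwise disjoint edges lying inside `S`. -/
def IsMatchingInside {n : ℕ} (S : Finset (Fin n)) (M : Finset (Sym2 (Fin n))) (m : ℕ) : Prop :=
  M.card = m ∧ (∀ e ∈ M, e ∈ edgesInside S) ∧
    (M : Set (Sym2 (Fin n))).Pairwise fun e f => ∀ v, v ∈ e → v ∉ f

theorem mk_mem_edgesInside {n : ℕ} {S : Finset (Fin n)} {x y : Fin n} :
    s(x, y) ∈ edgesInside S ↔ x ≠ y ∧ x ∈ S ∧ y ∈ S := by
  simp [edgesInside]

theorem edgesInside_mono {n : ℕ} {S T : Finset (Fin n)} (h : S ⊆ T) :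
    edgesInside S ⊆ edgesInside T :=
  fun _ he => ⟨he.1, fun v hv => h (he.2 v hv)⟩

theorem notMem_edgesInside_of_mem {n : ℕ} {S : Finset (Fin n)} {e : Sym2 (Fin n)} {v : Fin n}
    (hv : v ∈ e) (hS : v ∉ S) : e ∉ edgesInside S :=
  fun he => hS (he.2 v hv)

namespace IsMatchingInside

variable {n m : ℕ} {S : Finset (Fin n)} {M : Finset (Sym2 (Fin n))}

theorem mono {T : Finset (Fin n)} (hM : IsMatchingInside S M m) (h : S ⊆ T) :
    IsMatchingInside T M m :=
  ⟨hM.1, fun e he => edgesInside_mono h (hM.2.1 e he), hM.2.2⟩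

theorem insert_edge (hM : IsMatchingInside S M m) {x y : Fin n}
    (hx : x ∉ S) (hy : y ∉ S) (hxy : x ≠ y) :
    IsMatchingInside (insert x (insert y S)) (insert s(x, y) M) (m + 1) := by
  obtain ⟨hcard, hin, hdisj⟩ := hM
  have hnot : s(x, y) ∉ M := fun h => hx ((hin _ h).2 x (by simp))
  refine ⟨by rw [Finset.card_insert_of_notMem hnot, hcard], ?_, ?_⟩
  · intro e he
    rcases Finset.mem_insert.1 he with rfl | he
    · simp [mk_mem_edgesInside, hxy]
    · exact edgesInside_mono (fun v hv => by simp [hv]) (hin e he)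
  · rw [Finset.coe_insert, Set.pairwise_insert]
    refine ⟨hdisj, fun e he _ => ⟨?_, ?_⟩⟩
    · intro v hv hve
      have := (hin e he).2 v hve
      rcases Sym2.mem_iff.1 hv with rfl | rfl <;> contradiction
    · intro v hve hv
      have := (hin e he).2 v hve
      rcases Sym2.mem_iff.1 hv with rfl | rfl <;> contradiction

theorem hasRainbowMatching (hM : IsMatchingInside S M m) {c : Sym2 (Fin n) → ℕ}
    (hc : Set.InjOn c M) : HasRainbowMatching c m :=
  ⟨M, hM.1, fun e he => (hM.2.1 e he).1, hM.2.2, hc⟩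

end IsMatchingInside

theorem exists_isMatchingInside {n : ℕ} (m : ℕ) (S : Finset (Fin n)) (hS : S.card = 2 * m) :
    ∃ M, IsMatchingInside S M m := by
  induction m generalizing S with
  | zero => exact ⟨∅, by simp [IsMatchingInside]⟩
  | succ m ih =>
    obtain ⟨x, hx, y, hy, hxy⟩ := Finset.one_lt_card.1 (by omega : 1 < S.card)
    have hy' : y ∈ S.erase x := Finset.mem_erase.2 ⟨hxy.symm, hy⟩
    obtain ⟨M, hM⟩ := ih ((S.erase x).erase y) (by
      rw [Finset.card_erase_of_mem hy', Finset.card_erase_of_mem hx]; omega)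
    refine ⟨_, (hM.insert_edge (x := x) (y := y) (by simp) (by simp) hxy).mono ?_⟩
    rw [Finset.insert_erase hy', Finset.insert_erase hx]

/-- A set with at least four elements has a perfect matching avoiding a prescribed edge. -/
theorem exists_isMatchingInside_notMem {n m : ℕ} (hm : 2 ≤ m) (S : Finset (Fin n))
    (hS : S.card = 2 * m) (e : Sym2 (Fin n)) : ∃ M, IsMatchingInside S M m ∧ e ∉ M := by
  induction e with
  | h x y =>
    by_cases hx : x ∈ S
    · obtain ⟨z, hz, hzy⟩ := Finset.exists_mem_ne
        (by rw [Finset.card_erase_of_mem hx]; omega : 1 < (S.erase x).card) y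
      have hzx := Finset.ne_of_mem_erase hz
      obtain ⟨M, hM⟩ := exists_isMatchingInside (m - 1) ((S.erase x).erase z) (by
        rw [Finset.card_erase_of_mem hz, Finset.card_erase_of_mem hx]; omega)
      have hM' := hM.insert_edge (x := x) (y := z) (by simp) (by simp) hzx.symm
      rw [Finset.insert_erase hz, Finset.insert_erase hx, Nat.sub_add_cancel (by omega)] at hM'
      refine ⟨_, hM', ?_⟩
      rw [Finset.mem_insert, not_or]
      refine ⟨by grind [Sym2.eq_iff], fun h => ?_⟩
      exact notMem_edgesInside_of_mem (v := x) (by simp) (by simp) (hM.2.1 _ h)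
    · obtain ⟨M, hM⟩ := exists_isMatchingInside m S hS
      exact ⟨M, hM, fun h => notMem_edgesInside_of_mem (by simp) hx (hM.2.1 _ h)⟩

/-- Without a rainbow matching of size `k`, an edge `uw` between `U` and `W = {w, x, y}` has the
color of `xy`, unless `k = 3` and it has the color of the edge of `U` opposite to `u`. -/
theorem color_cross_edge {n k : ℕ} (hk : 3 ≤ k) {c : Sym2 (Fin n) → ℕ}
    {U : Finset (Fin n)} {w x y u : Fin n}
    (hUW : Disjoint U {w, x, y}) (hU : U.card = 2 * k - 3)
    (hwx : w ≠ x) (hwy : w ≠ y) (hxy : x ≠ y)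
    (hinj : Set.InjOn c (edgesInside U ∪ edgesInside {w, x, y}))
    (hrep : ∀ e : Sym2 (Fin n), ¬ e.IsDiag →
      ∃ e' ∈ edgesInside U ∪ edgesInside {w, x, y}, c e = c e')
    (hno : ¬ HasRainbowMatching c k) (hu : u ∈ U) :
    c s(u, w) = c s(x, y) ∨ k = 3 ∧ ∃ e ∈ edgesInside (U.erase u), c s(u, w) = c e := by
  have hwU : w ∉ U := fun h => Finset.disjoint_left.1 hUW h (by simp)
  have hxU : x ∉ U := fun h => Finset.disjoint_left.1 hUW h (by simp)
  have hyU : y ∉ U := fun h => Finset.disjoint_left.1 hUW h (by simp)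
  obtain ⟨e, he, hce⟩ := hrep s(u, w) (by simpa using fun h : u = w => hwU (h ▸ hu))
  by_contra! hcon
  have hexy : e ≠ s(x, y) := fun h => hcon.1 (h ▸ hce)
  have hcard : (U.erase u).card = 2 * (k - 2) := by
    rw [Finset.card_erase_of_mem hu]; omega
  have hM : ∃ M, IsMatchingInside (U.erase u) M (k - 2) ∧ e ∉ M := by
    by_cases hk3 : k = 3
    · obtain ⟨M, hM⟩ := exists_isMatchingInside (k - 2) _ hcard
      exact ⟨M, hM, fun h => hcon.2 hk3 e (hM.2.1 e h) hce⟩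
    · exact exists_isMatchingInside_notMem (by omega) _ hcard e
  obtain ⟨M, hM, heM⟩ := hM
  have hMU : ∀ f ∈ M, f ∈ edgesInside U :=
    fun f hf => edgesInside_mono (Finset.erase_subset _ _) (hM.2.1 f hf)
  have hxyW : s(x, y) ∈ edgesInside {w, x, y} := by simp [mk_mem_edgesInside, hxy]
  have hM1 := hM.insert_edge (x := x) (y := y) (by simp [hxU]) (by simp [hyU]) hxy
  have hM2 := hM1.insert_edge (x := u) (y := w) (by grind) (by grind) (by grind)
  rw [show k - 2 + 1 + 1 = k by omega] at hM2
  refine hno (hM2.hasRainbowMatching ?_)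
  have hA : ∀ f ∈ insert s(x, y) M, f ∈ edgesInside U ∪ edgesInside {w, x, y} := by
    intro f hf
    rcases Finset.mem_insert.1 hf with rfl | hf
    · exact Or.inr hxyW
    · exact Or.inl (hMU f hf)
  have huw : s(u, w) ∉ insert s(x, y) M := by
    rw [Finset.mem_insert, not_or]
    exact ⟨by grind [Sym2.eq_iff],
      fun h => notMem_edgesInside_of_mem (v := w) (by simp) hwU (hMU _ h)⟩
  rw [Finset.coe_insert, Set.injOn_insert (by exact_mod_cast huw)]
  refine ⟨hinj.mono hA, ?_⟩
  rintro ⟨f, hf, hfc⟩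
  have hfe : f = e := hinj (hA f hf) he (hfc.trans hce)
  subst hfe
  rcases Finset.mem_insert.1 hf with h | h
  exacts [hexy h, heM h]

/-- Claim 1: let `k ≥ 3`, `n ≥ 2k` and let `c` be an edge coloring of `K_n`. If there are
disjoint vertex sets `U`, `W` with `|U| = 2k-3` and `|W| = 3` such that the edges lying
inside `U` or inside `W` have pairwise distinct colors, and every edge of `K_n` has the
same color as some edge inside `U` or inside `W`, then `K_n` contains a rainbow matching
of size `k`. -/
theorem claim_one (n k : ℕ) (hk : 3 ≤ k) (hn : 2 * k ≤ n) (c : Sym2 (Fin n) → ℕ)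
    (U W : Finset (Fin n)) (hUW : Disjoint U W)
    (hU : U.card = 2 * k - 3) (hW : W.card = 3)
    (hinj : Set.InjOn c (edgesInside U ∪ edgesInside W))
    (hrep : ∀ e : Sym2 (Fin n), ¬ e.IsDiag →
      ∃ e' ∈ edgesInside U ∪ edgesInside W, c e = c e') :
    HasRainbowMatching c k := by
  by_contra hno
  obtain ⟨w₁, w₂, w₃, h12, h13, h23, rfl⟩ := Finset.card_eq_three.1 hW
  obtain ⟨T, hTU, hT⟩ := Finset.exists_subset_card_eq (by omega : 3 ≤ U.card)
  obtain ⟨u₁, u₂, u₃, g12, g13, g23, rfl⟩ := Finset.card_eq_three.1 hT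
  have hu₁ : u₁ ∈ U := hTU (by simp)
  have hu₂ : u₂ ∈ U := hTU (by simp)
  have hu₃ : u₃ ∈ U := hTU (by simp)
  have hd : ∀ u ∈ U, u ≠ w₁ ∧ u ≠ w₂ ∧ u ≠ w₃ := fun u hu => by
    simpa using Finset.disjoint_left.1 hUW hu
  have hp₂ : ({w₁, w₂, w₃} : Finset (Fin n)) = {w₂, w₁, w₃} := by grind
  have hp₃ : ({w₁, w₂, w₃} : Finset (Fin n)) = {w₃, w₁, w₂} := by grind
  have k₁ := color_cross_edge hk hUW hU h12 h13 h23 hinj hrep hno hu₁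
  have k₂ := color_cross_edge hk (hp₂ ▸ hUW) hU h12.symm h23 h13 (hp₂ ▸ hinj) (hp₂ ▸ hrep) hno hu₂
  have k₃ := color_cross_edge hk (hp₃ ▸ hUW) hU h13.symm h23.symm h12 (hp₃ ▸ hinj)
    (hp₃ ▸ hrep) hno hu₃
  obtain ⟨M, hM⟩ := exists_isMatchingInside (k - 3) (U \ {u₁, u₂, u₃}) (by
    rw [Finset.card_sdiff_of_subset hTU, hU, hT]; omega)
  have hM₁ := hM.insert_edge (x := u₁) (y := w₁) (by grind) (by grind) (by grind)
  have hM₂ := hM₁.insert_edge (x := u₂) (y := w₂) (by grind) (by grind) (by grind)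
  have hM₃ := hM₂.insert_edge (x := u₃) (y := w₃) (by grind) (by grind) (by grind)
  rw [show k - 3 + 1 + 1 + 1 = k by omega] at hM₃
  refine hno (hM₃.hasRainbowMatching ?_)
  have hMU : ∀ f ∈ M, f ∈ edgesInside U :=
    fun f hf => edgesInside_mono Finset.sdiff_subset (hM.2.1 f hf)
  -- each cross edge has the color of an edge opposite to one of its endpoints
  have key : ∀ u ∈ ({u₁, u₂, u₃} : Finset (Fin n)), ∀ w x y : Fin n,
      s(x, y) ∈ edgesInside {w₁, w₂, w₃} →
      (c s(u, w) = c s(x, y) ∨ k = 3 ∧ ∃ e ∈ edgesInside (U.erase u), c s(u, w) = c e) →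
      ∃ f ∈ edgesInside U ∪ edgesInside {w₁, w₂, w₃}, c s(u, w) = c f ∧ f ∉ M ∧
        (f = s(x, y) ∨ f ∈ edgesInside (({u₁, u₂, u₃} : Finset (Fin n)).erase u)) := by
    intro u hu w x y hxy h
    rcases h with h | ⟨rfl, e, he, h⟩
    · refine ⟨_, Or.inr hxy, h, fun hf => ?_, Or.inl rfl⟩
      exact Finset.disjoint_left.1 hUW ((hMU _ hf).2 x (by simp)) (hxy.2 x (by simp))
    · have hUT : ({u₁, u₂, u₃} : Finset (Fin n)) = U :=
        Finset.eq_of_subset_of_card_le hTU (by omega)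
      refine ⟨e, Or.inl (edgesInside_mono (Finset.erase_subset _ _) he), h, ?_, Or.inr (hUT ▸ he)⟩
      have : M = ∅ := Finset.card_eq_zero.1 hM.1
      simp [this]
  obtain ⟨f₁, A₁, c₁, n₁, o₁⟩ := key u₁ (by simp) w₁ w₂ w₃ (by simp [mk_mem_edgesInside, *]) k₁
  obtain ⟨f₂, A₂, c₂, n₂, o₂⟩ := key u₂ (by simp) w₂ w₁ w₃ (by simp [mk_mem_edgesInside, *]) k₂
  obtain ⟨f₃, A₃, c₃, n₃, o₃⟩ := key u₃ (by simp) w₃ w₁ w₂ (by simp [mk_mem_edgesInside, *]) k₃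
  have d₁ := hd u₁ hu₁
  have d₂ := hd u₂ hu₂
  have d₃ := hd u₃ hu₃
  have hf : f₁ ≠ f₂ ∧ f₁ ≠ f₃ ∧ f₂ ≠ f₃ := by
    clear key k₁ k₂ k₃ c₁ c₂ c₃ hM₁ hM₂ hM₃ hrep hinj hno
    induction f₁ with | h a₁ b₁
    induction f₂ with | h a₂ b₂
    induction f₃ with | h a₃ b₃
    simp only [mk_mem_edgesInside, Finset.mem_erase, Finset.mem_insert, Finset.mem_singleton,
      Sym2.eq_iff, ne_eq] at o₁ o₂ o₃ ⊢
    grind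
  have hMA : ∀ f ∈ M, f ∈ edgesInside U ∪ edgesInside {w₁, w₂, w₃} := fun f h => Or.inl (hMU f h)
  have hsep : ∀ f₀ ∈ edgesInside U ∪ edgesInside {w₁, w₂, w₃}, f₀ ∉ M →
      ∀ f ∈ M, c f ≠ c f₀ := fun f₀ h₀ hn f h hc => hn (hinj (hMA f h) h₀ hc ▸ h)
  have q₁ := hsep f₁ A₁ n₁
  have q₂ := hsep f₂ A₂ n₂
  have q₃ := hsep f₃ A₃ n₃
  have e12 : c f₁ ≠ c f₂ := fun h => hf.1 (hinj A₁ A₂ h)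
  have e13 : c f₁ ≠ c f₃ := fun h => hf.2.1 (hinj A₁ A₃ h)
  have e23 : c f₂ ≠ c f₃ := fun h => hf.2.2 (hinj A₂ A₃ h)
  have hMinj : ∀ f ∈ M, ∀ g ∈ M, c f = c g → f = g := fun f h g h' => hinj (hMA f h) (hMA g h')
  intro f h g h' hc
  simp only [Finset.coe_insert, Set.mem_insert_iff, Finset.mem_coe] at h h'
  clear key k₁ k₂ k₃ hM₁ hM₂ hM₃ hrep hinj hno o₁ o₂ o₃ hsep A₁ A₂ A₃ hMU hMA hM
  grind
end
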